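/- For all n ≥ 1, the sets 𝒮̇ₙ and 𝒮̇ₙ' are finite with card(𝒮̇ₙ) = card(𝒮̇ₙ') = 3·2^{4n+1}. -/

import Mathlib

noncomputable section

/-- The golden ratio τ = (1+√5)/2. -/
def gr : ℝ := (1 + Real.sqrt 5) / 2

/-- The ring ℤ[τ] as a subset of ℝ. -/
def Ztau : Set ℝ := {x : ℝ | ∃ a b : ℤ, x = (a : ℝ) + (b : ℝ) * gr}

/-- Congruence modulo 2ℤ[τ]. -/
def cong2 (x y : ℝ) : Prop := ∃ a b : ℤ, x - y = 2 * ((a : ℝ) + (b : ℝ) * gr)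

/-- The vector (0, 1, τ', τ) (for t = τ; its conjugate for t = τ'). -/
def v4 (t : ℝ) : Fin 4 → ℝ := ![0, 1, 1 - t, t]

/-- Representatives of the four classes of 𝔽₄ = ℤ[τ]/2ℤ[τ]. -/
def Reps : Set ℝ := {0, 1, gr, 1 + gr}

/-- `y` reduces mod 2ℤ[τ]⁴ into the 𝔽₄-span A of (1,1,1,1) and (0,1,τ',τ). -/
def inAmod (t : ℝ) (y : Fin 4 → ℝ) : Prop :=
  ∃ c ∈ Reps, ∃ d ∈ Reps, ∀ i, cong2 (y i) (c + d * v4 t i)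

/-- `y` reduces mod 2ℤ[τ]⁴ into Ȧ, the images of even permutations of (0,1,τ',τ). -/
def inAdot (t : ℝ) (y : Fin 4 → ℝ) : Prop :=
  ∃ σ : Equiv.Perm (Fin 4), Equiv.Perm.sign σ = 1 ∧ ∀ i, cong2 (y i) (v4 t (σ i))

/-- The spherical sets 𝒮̇ₙ (t = τ) resp. 𝒮̇ₙ' (t = τ'). -/
def sphSdot (t : ℝ) (n : ℕ) : Set (Fin 4 → ℝ) :=
  {x | (∑ i, x i ^ 2) = 1 ∧ (∀ i, 2 ^ n * x i ∈ Ztau) ∧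
    inAdot t (fun i => 2 ^ n * x i)}


open QuadraticAlgebra

/-- The ring ℤ[τ], presented as pairs of integers. -/
abbrev GoldenInt : Type := QuadraticAlgebra ℤ 1 1

namespace GoldenInt

/-- The golden ratio in `GoldenInt`. -/
def tau : GoldenInt := ⟨0, 1⟩

theorem tau_sq : tau ^ 2 = tau + 1 := by decide

theorem two_dvd_iff (x : GoldenInt) : 2 ∣ x ↔ x.re % 2 = 0 ∧ x.im % 2 = 0 := by
  constructor
  · rintro ⟨y, rfl⟩
    simp
  · rintro ⟨h1, h2⟩
    refine ⟨⟨x.re / 2, x.im / 2⟩, ?_⟩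
    ext <;> simp <;> omega

theorem two_dvd_or_two_dvd {x y : GoldenInt} (h : 2 ∣ x * y) : 2 ∣ x ∨ 2 ∣ y := by
  simp only [two_dvd_iff, re_mul, im_mul] at *
  obtain ⟨h1, h2⟩ := h
  rcases Int.emod_two_eq_zero_or_one x.re with a | a <;>
  rcases Int.emod_two_eq_zero_or_one x.im with b | b <;>
  rcases Int.emod_two_eq_zero_or_one y.re with c | c <;>
  rcases Int.emod_two_eq_zero_or_one y.im with d | d <;>
  simp [Int.add_emod, Int.mul_emod, a, b, c, d] at h1 h2 ⊢

/-- The four representatives of ℤ[τ] modulo 2. -/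
def rep : Fin 4 → GoldenInt := ![0, tau, 1, 1 - tau]

theorem exists_two_dvd_add_rep_mul (x : GoldenInt) {y : GoldenInt} (hy : ¬ 2 ∣ y) :
    ∃ q, 2 ∣ x + rep q * y := by
  simp only [two_dvd_iff, rep, Fin.exists_fin_succ, tau] at *
  simp
  omega

theorem rep_injective_mod {q r : Fin 4} {x y : GoldenInt} (hy : ¬ 2 ∣ y)
    (hq : 2 ∣ x + rep q * y) (hr : 2 ∣ x + rep r * y) : q = r := by
  have h : 2 ∣ (rep q - rep r) * y := by
    have := dvd_sub hq hr
    ring_nf at this ⊢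
    exact this
  have h' := (two_dvd_or_two_dvd h).resolve_right hy
  rw [two_dvd_iff] at h'
  clear h hq hr
  revert q r
  decide

end GoldenInt

open GoldenInt

/-- Coordinates of an icosian with respect to the basis of `IcoCoord.toVec`. -/
abbrev IcoCoord : Type := GoldenInt × GoldenInt × GoldenInt × GoldenInt

namespace IcoCoord

/-- Twice the icosian with given coordinates, as a vector of ℤ[τ]⁴. -/
def toVec : IcoCoord → GoldenInt × GoldenInt × GoldenInt × GoldenInt
  | (a, b, c, d) => (a, a + b, a + b * (1 - tau) + 2 * c, a + b * tau + 2 * d)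

/-- The quaternion norm of the icosian with given coordinates. -/
def nrm : IcoCoord → GoldenInt
  | (a, b, c, d) => a ^ 2 + a * b + b ^ 2 + c ^ 2 + d ^ 2 + a * c + a * d
      + (1 - tau) * b * c + tau * b * d

/-- Modulo 2, `side p` and `p.2.1` span a row of the 2×2 matrix representing `p`. -/
def side : IcoCoord → GoldenInt
  | (a, _, c, d) => a + tau * (c + d)

/-- Right multiplication by the quaternion unit `i`. -/
def mulI : IcoCoord → IcoCoord
  | (a, b, c, d) => (-a - b, 2 * a + b, tau * a + tau * b + d, -tau * a - c)

/-- Right multiplication by the quaternion unit `j`. -/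
def mulJ : IcoCoord → IcoCoord
  | (a, b, c, d) => (-a + (tau - 1) * b - 2 * c, (1 - 2 * tau) * b + 2 * c - 2 * d,
      a - b + tau * c + (1 - tau) * d, a + 2 * b + (1 - tau) * c + tau * d)

/-- Right multiplication by the quaternion unit `k`. -/
def mulK : IcoCoord → IcoCoord
  | (a, b, c, d) => (-a - tau * b - 2 * d, 2 * a + b + 2 * c + 2 * d,
      (tau - 1) * a + (tau - 1) * b + (tau - 1) * c + tau * d,
      (1 - tau) * a - tau * c + (1 - tau) * d)

/-- Right multiplication by the quaternion units `1`, `i`, `j`, `k`. -/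
def mulUnit : Fin 4 → IcoCoord → IcoCoord := ![id, mulI, mulJ, mulK]

/-- Right multiplication by an icosian of norm 2. -/
def step : IcoCoord → IcoCoord
  | (a, b, c, d) => (tau * a + c + d, (2 * tau - 1) * b - 2 * c, b,
      -a - b + (tau - 1) * (c + d))

/-- Right multiplication by the conjugate of the icosian defining `step`. -/
def stepConj : IcoCoord → IcoCoord
  | (a, b, c, d) => ((tau - 1) * a - c - d, 2 * c, -b + (2 * tau - 1) * c,
      a + b + (1 - tau) * c + tau * d)

theorem mulUnit_mulUnit (q : Fin 4) (p : IcoCoord) (hq : q ≠ 0) :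
    mulUnit q (mulUnit q p) = -p := by
  obtain ⟨a, b, c, d⟩ := p
  fin_cases q
  · simp at hq
  all_goals
    simp only [mulUnit, Fin.mk_one, Fin.reduceFinMk, Matrix.cons_val, mulI, mulJ, mulK,
      Prod.ext_iff, Prod.fst_neg, Prod.snd_neg]
    refine ⟨?_, ?_, ?_, ?_⟩ <;> ring_nf <;> simp only [tau_sq] <;> ring

theorem mulUnit_neg (q : Fin 4) (p : IcoCoord) : mulUnit q (-p) = -mulUnit q p := by
  obtain ⟨a, b, c, d⟩ := p
  fin_cases q
  · rfl
  all_goals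
    simp only [mulUnit, Fin.mk_one, Fin.reduceFinMk, Matrix.cons_val, mulI, mulJ, mulK,
      Prod.ext_iff, Prod.fst_neg, Prod.snd_neg]
    refine ⟨?_, ?_, ?_, ?_⟩ <;> ring

theorem nrm_neg (p : IcoCoord) : nrm (-p) = nrm p := by
  obtain ⟨a, b, c, d⟩ := p
  simp only [nrm]
  ring

theorem side_neg (p : IcoCoord) : side (-p) = -side p := by
  obtain ⟨a, b, c, d⟩ := p
  simp only [side]
  ring

theorem nrm_mulUnit (q : Fin 4) (p : IcoCoord) : nrm (mulUnit q p) = nrm p := by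
  obtain ⟨a, b, c, d⟩ := p
  fin_cases q
  · rfl
  all_goals
    simp only [mulUnit, Fin.mk_one, Fin.reduceFinMk, Matrix.cons_val, mulI, mulJ, mulK, nrm]
    ring_nf
    simp only [show tau ^ 3 = 2 * tau + 1 by decide, tau_sq]
    ring

theorem two_dvd_mulUnit (q : Fin 4) (p : IcoCoord) :
    2 ∣ (mulUnit q p).2.1 ↔ 2 ∣ p.2.1 := by
  obtain ⟨a, b, c, d⟩ := p
  fin_cases q
  · rfl
  all_goals
    simp only [mulUnit, Fin.mk_one, Fin.reduceFinMk, Matrix.cons_val, mulI, mulJ, mulK,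
      two_dvd_iff]
    simp [tau]

theorem two_dvd_side_mulUnit (q : Fin 4) (p : IcoCoord) :
    2 ∣ side (mulUnit q p) ↔ 2 ∣ side p + rep q * p.2.1 := by
  obtain ⟨a, b, c, d⟩ := p
  fin_cases q
  · simp [mulUnit, rep]
  all_goals
    simp only [mulUnit, rep, Fin.mk_one, Fin.reduceFinMk, Matrix.cons_val, mulI, mulJ, mulK,
      side, two_dvd_iff]
    simp [tau]
    omega

theorem nrm_step (p : IcoCoord) : nrm (step p) = 2 * nrm p := by
  obtain ⟨a, b, c, d⟩ := p
  simp only [step, nrm]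
  ring_nf
  simp only [show tau ^ 3 = 2 * tau + 1 by decide, tau_sq]
  ring

theorem two_dvd_step (p : IcoCoord) : 2 ∣ (step p).2.1 ↔ 2 ∣ p.2.1 := by
  obtain ⟨a, b, c, d⟩ := p
  simp only [step, two_dvd_iff]
  simp [tau]

theorem two_dvd_side_step (p : IcoCoord) : 2 ∣ side (step p) := by
  obtain ⟨a, b, c, d⟩ := p
  refine ⟨c + d, ?_⟩
  simp only [step, side]
  linear_combination (c + d) * tau_sq

theorem stepConj_step (p : IcoCoord) : stepConj (step p) = 2 * p := by
  obtain ⟨a, b, c, d⟩ := p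
  simp only [step, stepConj, Prod.ext_iff, Prod.fst_mul, Prod.snd_mul]
  refine ⟨?_, ?_, ?_, ?_⟩ <;> simp <;> ring_nf <;> simp only [tau_sq] <;> ring

theorem two_mul_cancel {x y : GoldenInt} (h : 2 * x = 2 * y) : x = y := by
  have h1 := congrArg QuadraticAlgebra.re h
  have h2 := congrArg QuadraticAlgebra.im h
  simp at h1 h2
  ext <;> assumption

theorem step_injective : Function.Injective step := by
  intro p r h
  have h' : (2 : IcoCoord) * p = 2 * r := by rw [← stepConj_step, h, stepConj_step]
  simp only [Prod.ext_iff, Prod.fst_mul, Prod.snd_mul] at h' ⊢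
  exact ⟨two_mul_cancel h'.1, two_mul_cancel h'.2.1, two_mul_cancel h'.2.2.1,
    two_mul_cancel h'.2.2.2⟩

theorem exists_step_eq {p : IcoCoord} (hb : ¬ 2 ∣ p.2.1) (hs : 2 ∣ side p)
    (hn : 2 ∣ nrm p) : ∃ r, step r = p := by
  obtain ⟨a, b, c, d⟩ := p
  simp only [side, nrm] at *
  have hbc : 2 ∣ b * (b + c) := by
    obtain ⟨u, hu⟩ := hs
    obtain ⟨v, hv⟩ := hn
    have ha : a = 2 * u - tau * (c + d) := by linear_combination hu
    subst ha
    refine ⟨v - (2 * u ^ 2 - 2 * u * tau * (c + d) + u * b + u * (c + d) - c * d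
      + (c + d) ^ 2 - tau * b * c), ?_⟩
    linear_combination hv - (c + d) ^ 2 * tau_sq
  obtain ⟨e, he⟩ := (two_dvd_or_two_dvd hbc).resolve_left hb
  obtain ⟨u, hu⟩ := hs
  refine ⟨((tau - 1) * u - c - d, c, -e + tau * c, u + e - tau * c), ?_⟩
  simp only [step, Prod.mk.injEq]
  refine ⟨?_, ?_, ?_, ?_⟩
  · linear_combination -hu + u * tau_sq
  · linear_combination -he
  · trivial
  · ring

/-- Icosians of norm `2 ^ m` outside the Hurwitz order over ℤ[τ]. -/
def sphere (m : ℕ) : Set IcoCoord := {p | ¬ 2 ∣ p.2.1 ∧ nrm p = 2 ^ m}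

theorem mulUnit_step_injOn (m : ℕ) :
    Set.InjOn (fun x : IcoCoord × Fin 4 => mulUnit x.2 (step x.1)) (sphere m ×ˢ Set.univ) := by
  have key (q : Fin 4) (p : IcoCoord) :
      2 ∣ side (mulUnit q (step p)) + rep q * (mulUnit q (step p)).2.1 := by
    rw [← two_dvd_side_mulUnit]
    by_cases hq : q = 0
    · subst hq
      exact two_dvd_side_step p
    · rw [mulUnit_mulUnit q _ hq, side_neg, dvd_neg]
      exact two_dvd_side_step p
  have inj (q : Fin 4) : Function.Injective (mulUnit q) := by
    by_cases hq : q = 0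
    · subst hq
      exact Function.injective_id
    · intro x y h
      have := congrArg (mulUnit q) h
      rwa [mulUnit_mulUnit q _ hq, mulUnit_mulUnit q _ hq, neg_inj] at this
  rintro ⟨p, q⟩ ⟨⟨hp, -⟩, -⟩ ⟨r, s⟩ - h
  dsimp only at h hp
  have hqs : q = s := by
    refine rep_injective_mod ?_ (key q p) (h ▸ key s r)
    rwa [two_dvd_mulUnit, two_dvd_step]
  subst hqs
  rw [step_injective (inj q h)]

theorem mulUnit_step_image (m : ℕ) :
    (fun x : IcoCoord × Fin 4 => mulUnit x.2 (step x.1)) '' (sphere m ×ˢ Set.univ)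
      = sphere (m + 1) := by
  ext p
  constructor
  · rintro ⟨⟨r, q⟩, ⟨⟨hr, hn⟩, -⟩, rfl⟩
    refine ⟨?_, ?_⟩
    · rwa [two_dvd_mulUnit, two_dvd_step]
    · rw [nrm_mulUnit, nrm_step, hn, pow_succ']
  · rintro ⟨hp, hn⟩
    obtain ⟨q, hq⟩ := exists_two_dvd_add_rep_mul (side p) hp
    rw [← two_dvd_side_mulUnit] at hq
    have hp' : ¬ 2 ∣ (mulUnit q p).2.1 := by rwa [two_dvd_mulUnit]
    have hn' : 2 ∣ nrm (mulUnit q p) := by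
      rw [nrm_mulUnit, hn, pow_succ']
      exact dvd_mul_right _ _
    obtain ⟨r, hr⟩ := exists_step_eq hp' hq hn'
    have mem : r ∈ sphere m := by
      refine ⟨?_, ?_⟩
      · rwa [← two_dvd_step, hr]
      · refine two_mul_cancel ?_
        rw [← nrm_step, hr, nrm_mulUnit, hn, pow_succ']
    by_cases h0 : q = 0
    · subst h0
      exact ⟨(r, 0), ⟨mem, trivial⟩, hr⟩
    · refine ⟨(-r, q), ⟨⟨?_, ?_⟩, trivial⟩, ?_⟩
      · simpa using mem.1
      · rw [nrm_neg, mem.2]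
      · have hs : step (-r) = -step r := by
          obtain ⟨a, b, c, d⟩ := r
          simp only [step, Prod.ext_iff, Prod.fst_neg, Prod.snd_neg]
          refine ⟨?_, ?_, trivial, ?_⟩ <;> ring
        simp only [hs, hr, mulUnit_neg, mulUnit_mulUnit q p h0, neg_neg]

theorem ncard_sphere_succ (m : ℕ) : (sphere (m + 1)).ncard = 4 * (sphere m).ncard := by
  rw [← mulUnit_step_image, (mulUnit_step_injOn m).ncard_image, Set.ncard_prod,
    Set.ncard_univ, Nat.card_fin, mul_comm]

theorem toVec_injective : Function.Injective toVec := by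
  rintro ⟨a, b, c, d⟩ ⟨a', b', c', d'⟩ h
  simp only [toVec, Prod.mk.injEq] at h ⊢
  obtain ⟨rfl, h1, h2, h3⟩ := h
  obtain rfl := add_left_cancel h1
  exact ⟨rfl, rfl, two_mul_cancel (add_left_cancel h2), two_mul_cancel (add_left_cancel h3)⟩

/-- The sum of the squares of the coordinates. -/
def sqNorm (y : GoldenInt × GoldenInt × GoldenInt × GoldenInt) : GoldenInt :=
  y.1 ^ 2 + y.2.1 ^ 2 + y.2.2.1 ^ 2 + y.2.2.2 ^ 2

theorem sqNorm_toVec (p : IcoCoord) : sqNorm (toVec p) = 4 * nrm p := by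
  obtain ⟨a, b, c, d⟩ := p
  simp only [toVec, sqNorm, nrm]
  linear_combination 2 * b ^ 2 * tau_sq

/-- The coordinates of vectors in `toVec '' sphere 0`. -/
def smallInts : Finset GoldenInt := {0, 1, -1, tau, -tau, 1 - tau, tau - 1}

/-- The vectors in `toVec '' sphere 0`. -/
def unitVecs : Finset (GoldenInt × GoldenInt × GoldenInt × GoldenInt) :=
  (smallInts ×ˢ smallInts ×ˢ smallInts ×ˢ smallInts).filter fun y =>
    let z := y.2.2.1 - y.1 - (y.2.1 - y.1) * (1 - tau)
    let w := y.2.2.2 - y.1 - (y.2.1 - y.1) * tau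
    ¬ ((y.2.1 - y.1).re % 2 = 0 ∧ (y.2.1 - y.1).im % 2 = 0) ∧
      (z.re % 2 = 0 ∧ z.im % 2 = 0) ∧ (w.re % 2 = 0 ∧ w.im % 2 = 0) ∧ sqNorm y = 4

theorem card_unitVecs : unitVecs.card = 96 := by decide +kernel

/-- The trace of `x ^ 2` is bounded below in terms of the class of `x` modulo 2. -/
theorem trace_sq_bound (x : GoldenInt) :
    let t := 2 * x.re ^ 2 + 2 * (x.re * x.im) + 3 * x.im ^ 2
    let l := 2 * (x.re % 2) + 3 * (x.im % 2) - 2 * ((x.re % 2) * (x.im % 2))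
    l ≤ t ∧ (t ≤ l → x ∈ smallInts) := by
  obtain ⟨a, b⟩ := x
  dsimp only
  have hl : 2 * (a % 2) + 3 * (b % 2) - 2 * ((a % 2) * (b % 2)) ≤ 3 := by
    rcases Int.emod_two_eq_zero_or_one a with h | h <;>
      rcases Int.emod_two_eq_zero_or_one b with h' | h' <;> rw [h, h'] <;> decide
  by_cases h : 2 * a ^ 2 + 2 * (a * b) + 3 * b ^ 2 ≤ 3
  · have hb : b ^ 2 ≤ 1 := by nlinarith [sq_nonneg (2 * a + b)]
    have ha : a ^ 2 ≤ 1 := by nlinarith [sq_nonneg (3 * b + a)]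
    obtain ⟨hb1, hb2⟩ := abs_le.mp ((sq_le_one_iff_abs_le_one b).mp hb)
    obtain ⟨ha1, ha2⟩ := abs_le.mp ((sq_le_one_iff_abs_le_one a).mp ha)
    interval_cases a <;> interval_cases b <;> revert h <;> decide
  · exact ⟨by omega, fun h' => absurd (h'.trans hl) h⟩

theorem toVec_image_sphere_zero : toVec '' sphere 0 = unitVecs := by
  ext y
  simp only [unitVecs, Finset.coe_filter, Finset.mem_product, Set.mem_ofPred_eq, ← two_dvd_iff]
  constructor
  · rintro ⟨p, ⟨hp, hn⟩, rfl⟩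
    have hsq := sqNorm_toVec p
    rw [hn] at hsq
    obtain ⟨a, b, c, d⟩ := p
    simp only [toVec, pow_zero, mul_one] at *
    have e1 : a + b - a = b := by ring
    refine ⟨?_, by rwa [e1], ⟨c, by ring⟩, ⟨d, by ring⟩, hsq⟩
    obtain ⟨l0, u0⟩ := trace_sq_bound a
    obtain ⟨l1, u1⟩ := trace_sq_bound (a + b)
    obtain ⟨l2, u2⟩ := trace_sq_bound (a + b * (1 - tau) + 2 * c)
    obtain ⟨l3, u3⟩ := trace_sq_bound (a + b * tau + 2 * d)
    have hre := congrArg QuadraticAlgebra.re hsq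
    have him := congrArg QuadraticAlgebra.im hsq
    simp only [sqNorm] at hre him
    have r1 : (a + b).re = a.re + b.re := by simp
    have i1 : (a + b).im = a.im + b.im := by simp
    have r2 : (a + b * (1 - tau) + 2 * c).re = a.re + b.re - b.im + 2 * c.re := by
      simp [tau]; ring
    have i2 : (a + b * (1 - tau) + 2 * c).im = a.im - b.re + 2 * c.im := by
      simp [tau]; ring
    have r3 : (a + b * tau + 2 * d).re = a.re + b.im + 2 * d.re := by simp [tau]
    have i3 : (a + b * tau + 2 * d).im = a.im + b.re + b.im + 2 * d.im := by
      simp [tau]; ring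
    generalize a + b = x1 at *
    generalize a + b * (1 - tau) + 2 * c = x2 at *
    generalize a + b * tau + 2 * d = x3 at *
    have htr : (2 * a.re ^ 2 + 2 * (a.re * a.im) + 3 * a.im ^ 2)
        + (2 * x1.re ^ 2 + 2 * (x1.re * x1.im) + 3 * x1.im ^ 2)
        + (2 * x2.re ^ 2 + 2 * (x2.re * x2.im) + 3 * x2.im ^ 2)
        + (2 * x3.re ^ 2 + 2 * (x3.re * x3.im) + 3 * x3.im ^ 2) = 8 := by
      simp [sq] at hre him
      linarith
    rw [two_dvd_iff] at hp
    have hpar : (2 * (a.re % 2) + 3 * (a.im % 2) - 2 * ((a.re % 2) * (a.im % 2)))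
        + (2 * (x1.re % 2) + 3 * (x1.im % 2) - 2 * ((x1.re % 2) * (x1.im % 2)))
        + (2 * (x2.re % 2) + 3 * (x2.im % 2) - 2 * ((x2.re % 2) * (x2.im % 2)))
        + (2 * (x3.re % 2) + 3 * (x3.im % 2) - 2 * ((x3.re % 2) * (x3.im % 2))) = 8 := by
      have s1 : x1.re % 2 = (a.re % 2 + b.re % 2) % 2 := by omega
      have t1 : x1.im % 2 = (a.im % 2 + b.im % 2) % 2 := by omega
      have s2 : x2.re % 2 = (a.re % 2 + b.re % 2 + b.im % 2) % 2 := by omega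
      have t2 : x2.im % 2 = (a.im % 2 + b.re % 2) % 2 := by omega
      have s3 : x3.re % 2 = (a.re % 2 + b.im % 2) % 2 := by omega
      have t3 : x3.im % 2 = (a.im % 2 + b.re % 2 + b.im % 2) % 2 := by omega
      rw [s1, t1, s2, t2, s3, t3]
      rcases Int.emod_two_eq_zero_or_one a.re with h1 | h1 <;>
      rcases Int.emod_two_eq_zero_or_one a.im with h2 | h2 <;>
      rcases Int.emod_two_eq_zero_or_one b.re with h3 | h3 <;>
      rcases Int.emod_two_eq_zero_or_one b.im with h4 | h4 <;>
      simp [h1, h2, h3, h4] at hp ⊢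
    exact ⟨u0 (by linarith), u1 (by linarith), u2 (by linarith), u3 (by linarith)⟩
  · rintro ⟨-, hb, ⟨c, hc⟩, ⟨d, hd⟩, hn⟩
    obtain ⟨y0, y1, y2, y3⟩ := y
    dsimp only at *
    have e : toVec (y0, y1 - y0, c, d) = (y0, y1, y2, y3) := by
      simp only [toVec, Prod.mk.injEq]
      refine ⟨trivial, by ring, by linear_combination -hc, by linear_combination -hd⟩
    refine ⟨_, ⟨hb, ?_⟩, e⟩
    refine two_mul_cancel (two_mul_cancel ?_)
    have := sqNorm_toVec (y0, y1 - y0, c, d)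
    rw [e, hn] at this
    linear_combination -this

theorem ncard_sphere (m : ℕ) : (sphere m).ncard = 96 * 4 ^ m := by
  induction m with
  | zero =>
    rw [← Set.ncard_image_of_injective _ toVec_injective, toVec_image_sphere_zero,
      Set.ncard_coe_finset, card_unitVecs, pow_zero, mul_one]
  | succ m ih => rw [ncard_sphere_succ, ih, pow_succ]; ring

end IcoCoord

/-- The ring homomorphism ℤ[τ] → ℝ. -/
def toReal : GoldenInt →ₐ[ℤ] ℝ :=
  QuadraticAlgebra.lift ⟨gr, by
    have := Real.goldenRatio_sq
    rw [sq] at this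
    simpa [gr, Real.goldenRatio, add_comm] using this⟩

theorem toReal_apply (x : GoldenInt) : toReal x = x.re + x.im * gr := by
  simp [toReal, QuadraticAlgebra.lift]

theorem toReal_injective : Function.Injective toReal := by
  rw [injective_iff_map_eq_zero]
  intro x hx
  rw [toReal_apply] at hx
  have him : x.im = 0 := by
    by_contra h
    refine Real.goldenRatio_irrational ⟨-x.re / x.im, ?_⟩
    have h' : (x.im : ℝ) ≠ 0 := by exact_mod_cast h
    push_cast
    rw [div_eq_iff h']
    have : Real.goldenRatio = gr := rfl
    rw [this]
    linarith
  rw [him] at hx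
  ext
  · simpa using hx
  · exact him

theorem toReal_tau : toReal tau = gr := by simp [toReal_apply, tau]

theorem mem_Ztau_iff (x : ℝ) : x ∈ Ztau ↔ ∃ y, toReal y = x := by
  constructor
  · rintro ⟨a, b, rfl⟩
    exact ⟨⟨a, b⟩, toReal_apply _⟩
  · rintro ⟨y, rfl⟩
    exact ⟨y.re, y.im, toReal_apply y⟩

theorem cong2_toReal_iff (x y : GoldenInt) : cong2 (toReal x) (toReal y) ↔ 2 ∣ x - y := by
  constructor
  · rintro ⟨a, b, h⟩
    refine ⟨⟨a, b⟩, toReal_injective ?_⟩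
    rw [map_sub, h, map_mul, toReal_apply ⟨a, b⟩, map_ofNat]
  · rintro ⟨z, hz⟩
    refine ⟨z.re, z.im, ?_⟩
    rw [← map_sub, hz, map_mul, toReal_apply z, map_ofNat]

/-- The vector (0, 1, τ', τ) over `GoldenInt`. -/
def baseVec : Fin 4 → GoldenInt := ![0, 1, 1 - tau, tau]

theorem v4_gr (i : Fin 4) : v4 gr i = toReal (baseVec i) := by
  fin_cases i <;> simp [v4, baseVec, toReal_tau]

/-- The vector with the given four entries. -/
def vecFun (y : GoldenInt × GoldenInt × GoldenInt × GoldenInt) : Fin 4 → GoldenInt :=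
  ![y.1, y.2.1, y.2.2.1, y.2.2.2]

theorem two_dvd_baseVec_perm (σ : Equiv.Perm (Fin 4)) (hσ : Equiv.Perm.sign σ = 1) :
    let w := fun i => baseVec (σ i)
    ¬ 2 ∣ w 1 - w 0 ∧ 2 ∣ w 2 - w 0 - (w 1 - w 0) * (1 - tau) ∧
      2 ∣ w 3 - w 0 - (w 1 - w 0) * tau := by
  simp only [two_dvd_iff]
  revert σ
  decide +kernel

theorem exists_perm_rep (q r : Fin 4) (hr : r ≠ 0) :
    ∃ σ : Equiv.Perm (Fin 4), Equiv.Perm.sign σ = 1 ∧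
      ∀ i, 2 ∣ vecFun (IcoCoord.toVec (rep q, rep r, 0, 0)) i - baseVec (σ i) := by
  simp only [two_dvd_iff]
  revert q r
  decide +kernel

theorem exists_perm_iff (y : Fin 4 → GoldenInt) :
    (∃ σ : Equiv.Perm (Fin 4), Equiv.Perm.sign σ = 1 ∧ ∀ i, 2 ∣ y i - baseVec (σ i)) ↔
      ∃ p : IcoCoord, ¬ 2 ∣ p.2.1 ∧ vecFun (IcoCoord.toVec p) = y := by
  constructor
  · rintro ⟨σ, hσ, h⟩
    obtain ⟨h1, ⟨c, hc⟩, ⟨d, hd⟩⟩ := two_dvd_baseVec_perm σ hσ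
    choose z hz using h
    refine ⟨(y 0, y 1 - y 0, c + z 2 - z 0 - (z 1 - z 0) * (1 - tau),
      d + z 3 - z 0 - (z 1 - z 0) * tau), ?_, ?_⟩
    · intro h2
      refine h1 ?_
      have := dvd_sub h2 (Dvd.intro (z 1 - z 0) rfl)
      convert this using 1
      linear_combination hz 0 - hz 1
    · funext i
      fin_cases i
      · rfl
      · simp [vecFun, IcoCoord.toVec]
      · simp only [vecFun, IcoCoord.toVec, Fin.reduceFinMk, Matrix.cons_val]
        linear_combination hz 0 - hz 2 - hc + (hz 1 - hz 0) * (1 - tau)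
      · simp only [vecFun, IcoCoord.toVec, Fin.reduceFinMk, Matrix.cons_val]
        linear_combination hz 0 - hz 3 - hd + (hz 1 - hz 0) * tau
  · rintro ⟨⟨a, b, c, d⟩, hb, rfl⟩
    have h1 : ¬ (2 : GoldenInt) ∣ 1 := by
      rw [two_dvd_iff]
      decide
    obtain ⟨q, u, hu⟩ := exists_two_dvd_add_rep_mul a h1
    obtain ⟨r, v, hv⟩ := exists_two_dvd_add_rep_mul b h1
    have hr : r ≠ 0 := by
      rintro rfl
      exact hb ⟨v, by simpa [rep] using hv⟩
    obtain ⟨σ, hσ, h⟩ := exists_perm_rep q r hr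
    refine ⟨σ, hσ, fun i => ?_⟩
    have key : 2 ∣ vecFun (IcoCoord.toVec (a, b, c, d)) i
        - vecFun (IcoCoord.toVec (rep q, rep r, 0, 0)) i := by
      fin_cases i
      · refine ⟨u - rep q, ?_⟩
        simp only [vecFun, IcoCoord.toVec, Fin.zero_eta, Matrix.cons_val]
        linear_combination hu
      · refine ⟨u + v - rep q - rep r, ?_⟩
        simp only [vecFun, IcoCoord.toVec, Fin.mk_one, Matrix.cons_val]
        linear_combination hu + hv
      · refine ⟨u - rep q + (v - rep r) * (1 - tau) + c, ?_⟩
        simp only [vecFun, IcoCoord.toVec, Fin.reduceFinMk, Matrix.cons_val]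
        linear_combination hu + hv * (1 - tau)
      · refine ⟨u - rep q + (v - rep r) * tau + d, ?_⟩
        simp only [vecFun, IcoCoord.toVec, Fin.reduceFinMk, Matrix.cons_val]
        linear_combination hu + hv * tau
    simpa using dvd_add key (h i)

theorem sphSdot_gr_eq (k : ℕ) :
    sphSdot gr (k + 1) =
      (fun p i => toReal (vecFun (IcoCoord.toVec p) i) / 2 ^ (k + 1)) ''
        IcoCoord.sphere (2 * k) := by
  have hpow : (2 : ℝ) ^ (k + 1) ≠ 0 := by positivity
  have hnorm (p : IcoCoord) : ∑ i, (toReal (vecFun (IcoCoord.toVec p) i) / 2 ^ (k + 1)) ^ 2 = 1 ↔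
      IcoCoord.nrm p = 2 ^ (2 * k) := by
    have h1 : ∑ i, (toReal (vecFun (IcoCoord.toVec p) i) / 2 ^ (k + 1)) ^ 2
        = toReal (IcoCoord.nrm p) / 2 ^ (2 * k) := by
      have h2 : ∑ i, toReal (vecFun (IcoCoord.toVec p) i) ^ 2 = 4 * toReal (IcoCoord.nrm p) := by
        have := congrArg toReal (IcoCoord.sqNorm_toVec p)
        rw [map_mul, map_ofNat] at this
        simpa [IcoCoord.sqNorm, Fin.sum_univ_four, vecFun] using this
      simp only [div_pow]
      rw [← Finset.sum_div, h2, ← pow_mul, show (k + 1) * 2 = 2 * k + 2 by ring, pow_add]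
      norm_num
      ring
    rw [h1, div_eq_one_iff_eq (by positivity), ← toReal_injective.eq_iff, map_pow, map_ofNat]
  have hdot (y : Fin 4 → GoldenInt) : inAdot gr (fun i => toReal (y i)) ↔
      ∃ p : IcoCoord, ¬ 2 ∣ p.2.1 ∧ vecFun (IcoCoord.toVec p) = y := by
    simp only [inAdot, v4_gr, cong2_toReal_iff, exists_perm_iff]
  ext x
  constructor
  · rintro ⟨hx, hint, hA⟩
    simp only [mem_Ztau_iff] at hint
    choose y hy using hint
    simp only [← hy] at hA
    obtain ⟨p, hp, rfl⟩ := (hdot y).mp hA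
    have hxy : (fun i => toReal (vecFun (IcoCoord.toVec p) i) / 2 ^ (k + 1)) = x := by
      funext i
      rw [hy, mul_div_cancel_left₀ _ hpow]
    exact ⟨p, ⟨hp, (hnorm p).mp (by simpa only [← hxy] using hx)⟩, hxy⟩
  · rintro ⟨p, ⟨hp, hn⟩, rfl⟩
    refine ⟨(hnorm p).mpr hn, ?_, ?_⟩
    · intro i
      rw [mul_div_cancel₀ _ hpow, mem_Ztau_iff]
      exact ⟨_, rfl⟩
    · simp only [mul_div_cancel₀ _ hpow]
      exact (hdot _).mpr ⟨p, hp, rfl⟩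

theorem ncard_sphSdot_gr (k : ℕ) : (sphSdot gr (k + 1)).ncard = 96 * 4 ^ (2 * k) := by
  rw [sphSdot_gr_eq, Set.ncard_image_of_injective, IcoCoord.ncard_sphere]
  intro p r h
  apply IcoCoord.toVec_injective
  have h' (i : Fin 4) : vecFun (IcoCoord.toVec p) i = vecFun (IcoCoord.toVec r) i :=
    toReal_injective ((div_left_inj' (by positivity)).mp (congrFun h i))
  exact Prod.ext (h' 0) (Prod.ext (h' 1) (Prod.ext (h' 2) (h' 3)))

theorem v4_one_sub (t : ℝ) (i : Fin 4) : v4 (1 - t) i = v4 t (Equiv.swap 2 3 i) := by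
  fin_cases i
  · rfl
  · rfl
  · simp [v4]
  · simp [v4]

theorem comp_swap_mem_sphSdot {t : ℝ} {n : ℕ} {x : Fin 4 → ℝ} (hx : x ∈ sphSdot t n) :
    x ∘ Equiv.swap 2 3 ∈ sphSdot (1 - t) n := by
  obtain ⟨h1, h2, σ, hσ, h3⟩ := hx
  refine ⟨?_, fun i => h2 _, Equiv.swap 2 3 * σ * Equiv.swap 2 3, by simp [hσ], fun i => ?_⟩
  · rw [← h1]
    exact Equiv.sum_comp (Equiv.swap 2 3) (fun i => x i ^ 2)
  · simpa [v4_one_sub] using h3 (Equiv.swap 2 3 i)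

theorem ncard_sphSdot_one_sub (t : ℝ) (n : ℕ) :
    (sphSdot (1 - t) n).ncard = (sphSdot t n).ncard := by
  have hinv (x : Fin 4 → ℝ) : (x ∘ Equiv.swap 2 3) ∘ Equiv.swap 2 3 = x := by
    funext i
    simp
  have himage : (fun x : Fin 4 → ℝ => x ∘ Equiv.swap 2 3) '' sphSdot t n = sphSdot (1 - t) n := by
    ext x
    constructor
    · rintro ⟨y, hy, rfl⟩
      exact comp_swap_mem_sphSdot hy
    · intro hx
      have := comp_swap_mem_sphSdot hx
      rw [sub_sub_cancel] at this
      exact ⟨_, this, hinv x⟩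
  rw [← himage, Set.ncard_image_of_injective]
  intro x y h
  rw [← hinv x, ← hinv y]
  exact congrArg (· ∘ Equiv.swap 2 3) h

theorem statement10 (n : ℕ) (hn : 1 ≤ n) :
    (sphSdot gr n).Finite ∧ (sphSdot (1 - gr) n).Finite ∧
    (sphSdot gr n).ncard = 3 * 2 ^ (4 * n + 1) ∧
    (sphSdot (1 - gr) n).ncard = 3 * 2 ^ (4 * n + 1) := by
  have h : (sphSdot gr n).ncard = 3 * 2 ^ (4 * n + 1) := by
    obtain ⟨k, rfl⟩ := Nat.exists_eq_add_of_le' hn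
    rw [ncard_sphSdot_gr, show 4 * (k + 1) + 1 = 2 * (2 * k) + 5 by ring, pow_add, pow_mul 2 2]
    norm_num
    ring
  have h' := (ncard_sphSdot_one_sub gr n).trans h
  exact ⟨Set.finite_of_ncard_ne_zero (by rw [h]; positivity),
    Set.finite_of_ncard_ne_zero (by rw [h']; positivity), h, h'⟩
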